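/- Let n ≥ 3 be an integer and let H₀ be a real number with −((n−2)/2)·((n−2)/n)^(n/2) < H₀ < 0. Then there exists a unique bounded, twice continuously differentiable function v : ℝ → ℝ with v(t) > 0 for all t ∈ ℝ that satisfies the Delaunay ODE v''(t) − ((n−2)²/4)·v(t) + (n·(n−2)/4)·v(t)^((n+2)/(n−2)) = 0 for all t ∈ ℝ together with H(v(0), v'(0)) = H₀, v'(0) = 0 and v''(0) > 0. Moreover this v is periodic, satisfies 0 < v(t) < 1 for all t ∈ ℝ, and v(0) = min_{t∈ℝ} v(t) with 0 < v(0) < ((n−2)/n)^((n−2)/4). -/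

import Mathlib

/-- The Delaunay ODE: `v'' − ((n−2)²/4)·v + (n·(n−2)/4)·v^((n+2)/(n−2)) = 0`. -/
def DelaunayODE (n : ℕ) (v : ℝ → ℝ) : Prop :=
  ∀ t : ℝ, deriv (deriv v) t - (((n : ℝ) - 2) ^ 2 / 4) * v t
    + ((n : ℝ) * ((n : ℝ) - 2) / 4) * v t ^ (((n : ℝ) + 2) / ((n : ℝ) - 2)) = 0

/-- The Hamiltonian energy of the Delaunay ODE:
`H(v, w) = w² − ((n−2)²/4)·v² + ((n−2)²/4)·v^(2n/(n−2))`. -/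
noncomputable def delaunayH (n : ℕ) (v w : ℝ) : ℝ :=
  w ^ 2 - (((n : ℝ) - 2) ^ 2 / 4) * v ^ 2
    + (((n : ℝ) - 2) ^ 2 / 4) * v ^ (2 * (n : ℝ) / ((n : ℝ) - 2))

/-- The defining conditions: `v` bounded, C², positive, solves the Delaunay ODE,
has energy `H₀`, `v'(0) = 0` and `v''(0) > 0`. -/
def DelaunaySol (n : ℕ) (H₀ : ℝ) (v : ℝ → ℝ) : Prop :=
  (∃ C : ℝ, ∀ t : ℝ, |v t| ≤ C) ∧ ContDiff ℝ 2 v ∧ (∀ t : ℝ, 0 < v t) ∧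
    DelaunayODE n v ∧ delaunayH n (v 0) (deriv v 0) = H₀ ∧
    deriv v 0 = 0 ∧ 0 < deriv (deriv v) 0

open Set Filter Topology

/-- Potential energy `F x = c (x^p - x^2)`. -/
noncomputable def dF (c p x : ℝ) : ℝ := c * (x ^ p - x ^ 2)
/-- Force, minus half the derivative of F. -/
noncomputable def dg (c p x : ℝ) : ℝ := c * x - c * p / 2 * x ^ (p - 1)

lemma dF_hasDerivAt {c p : ℝ} (hp : 2 < p) (x : ℝ) :
    HasDerivAt (dF c p) (-2 * dg c p x) x := by
  have h1 : HasDerivAt (fun x : ℝ => x ^ p) (p * x ^ (p - 1)) x :=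
    Real.hasDerivAt_rpow_const (Or.inr (by linarith))
  have h2 : HasDerivAt (fun x : ℝ => x ^ 2) (2 * x) x := by simpa using hasDerivAt_pow 2 x
  have h := (h1.sub h2).const_mul c
  refine h.congr_deriv ?_
  unfold dg; ring

lemma dg_contDiff {c p : ℝ} (hp : 2 < p) : ContDiff ℝ 1 (dg c p) := by
  have h1 : ContDiff ℝ 1 (fun x : ℝ => x ^ (p - 1)) := by
    have := Real.contDiff_rpow_const_of_le (p := p - 1) (n := 1) (by push_cast; linarith)
    exact_mod_cast this
  unfold dg
  exact (contDiff_const.mul contDiff_id).sub (contDiff_const.mul h1)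

lemma dg_eq {c p x : ℝ} (hx : 0 < x) : dg c p x = c * x * (1 - p / 2 * x ^ (p - 2)) := by
  have : x ^ (p - 1) = x ^ (p - 2) * x := by
    rw [← Real.rpow_add_one hx.ne']; congr 1; ring
  unfold dg; rw [this]; ring

/-- Equilibrium. -/
noncomputable def ds (p : ℝ) : ℝ := (2 / p) ^ (1 / (p - 2))

lemma ds_pos {p : ℝ} (hp : 2 < p) : 0 < ds p := Real.rpow_pos_of_pos (by positivity) _

lemma ds_pow {p : ℝ} (hp : 2 < p) : ds p ^ (p - 2) = 2 / p := by
  unfold ds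
  rw [← Real.rpow_mul (by positivity), one_div, inv_mul_cancel₀ (by linarith), Real.rpow_one]

lemma dg_eq' {c p x : ℝ} (hp : 2 < p) (hx : 0 < x) :
    dg c p x = c * p / 2 * x * (ds p ^ (p - 2) - x ^ (p - 2)) := by
  rw [dg_eq hx, ds_pow hp]; field_simp

lemma dg_pos_iff {c p x : ℝ} (hc : 0 < c) (hp : 2 < p) (hx : 0 < x) :
    0 < dg c p x ↔ x < ds p := by
  rw [dg_eq' hp hx, mul_pos_iff_of_pos_left (by positivity), sub_pos,
    Real.rpow_lt_rpow_iff hx.le (ds_pos hp).le (by linarith)]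

lemma dg_eq_zero {c p x : ℝ} (hc : 0 < c) (hp : 2 < p) (hx : 0 < x) (h : dg c p x = 0) :
    x = ds p := by
  have h0 : c * p / 2 * x ≠ 0 := by positivity
  rw [dg_eq' hp hx, mul_eq_zero, or_iff_right h0, sub_eq_zero] at h
  exact ((Real.rpow_left_inj hx.le (ds_pos hp).le (by linarith)).1 h.symm)

lemma dF_cont {c p : ℝ} (hp : 2 < p) : Continuous (dF c p) :=
  continuous_iff_continuousAt.2 fun x => (dF_hasDerivAt hp x).continuousAt

lemma dF_anti {c p : ℝ} (hc : 0 < c) (hp : 2 < p) : StrictAntiOn (dF c p) (Icc 0 (ds p)) := by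
  apply strictAntiOn_of_deriv_neg (convex_Icc _ _) (dF_cont hp).continuousOn
  intro x hx
  rw [interior_Icc] at hx
  rw [(dF_hasDerivAt hp x).deriv]
  have := (dg_pos_iff hc hp hx.1).2 hx.2
  linarith

lemma lt_one_of_dF_neg {c p x : ℝ} (hc : 0 < c) (hp : 2 < p) (h : dF c p x < 0) :
    x < 1 := by
  by_contra h1
  push Not at h1
  have : x ^ (2:ℝ) ≤ x ^ p := Real.rpow_le_rpow_of_exponent_le h1 hp.le
  rw [Real.rpow_two] at this
  unfold dF at h
  nlinarith

lemma dF_zero {c p : ℝ} (hp : 2 < p) : dF c p 0 = 0 := by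
  unfold dF; rw [Real.zero_rpow (by linarith)]; simp

lemma dF_ge {c p x : ℝ} (hc : 0 < c) (hx : 0 ≤ x) (hx1 : x ≤ 1) : -c ≤ dF c p x := by
  have := Real.rpow_nonneg hx p
  have : x ^ 2 ≤ 1 := by nlinarith
  unfold dF; nlinarith

/-- A global solution of the first order system. -/
def IsSol (c p : ℝ) (v w : ℝ → ℝ) : Prop :=
  (∀ t, HasDerivAt v (w t) t) ∧ ∀ t, HasDerivAt w (dg c p (v t)) t

lemma energy {c p : ℝ} (hp : 2 < p) {v w : ℝ → ℝ} (h : IsSol c p v w) (t : ℝ) :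
    w t ^ 2 + dF c p (v t) = w 0 ^ 2 + dF c p (v 0) := by
  have hd : ∀ t, HasDerivAt (fun t => w t ^ 2 + dF c p (v t)) 0 t := by
    intro t
    have h1 := (h.2 t).pow 2
    have h2 := (dF_hasDerivAt (c := c) hp (v t)).comp t (h.1 t)
    refine (h1.add h2).congr_deriv ?_
    simp; ring
  exact is_const_of_deriv_eq_zero (fun t => (hd t).differentiableAt) (fun t => (hd t).deriv) t 0

lemma exists_lip {c p : ℝ} (hp : 2 < p) : ∃ K, LipschitzOnWith K (dg c p) (Icc 0 1) :=
  (dg_contDiff hp).contDiffOn.exists_lipschitzOnWith (by norm_num) (convex_Icc _ _) isCompact_Icc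

lemma sol_unique {c p : ℝ} (hp : 2 < p) {v w v' w' : ℝ → ℝ} (h : IsSol c p v w)
    (h' : IsSol c p v' w') (hv : ∀ t, v t ∈ Icc (0:ℝ) 1) (hv' : ∀ t, v' t ∈ Icc (0:ℝ) 1) (t₀ : ℝ)
    (h1 : v t₀ = v' t₀) (h2 : w t₀ = w' t₀) : v = v' := by
  obtain ⟨K, hK⟩ := exists_lip (c := c) hp
  have hl : LipschitzOnWith (max 1 K) (fun q : ℝ × ℝ => (q.2, dg c p q.1)) (Icc 0 1 ×ˢ univ) := by
    apply LipschitzOnWith.prodMk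
    · exact LipschitzWith.prod_snd.lipschitzOnWith
    · have := hK.comp (LipschitzWith.prod_fst (α := ℝ) (β := ℝ)).lipschitzOnWith
        (s := Icc 0 1 ×ˢ univ) (fun q hq => hq.1)
      simpa [Function.comp_def] using this
  have := ODE_solution_unique_univ (v := fun (_ : ℝ) (q : ℝ × ℝ) => (q.2, dg c p q.1))
    (s := fun _ => Icc 0 1 ×ˢ univ) (f := fun t => (v t, w t)) (g := fun t => (v' t, w' t))
    (t₀ := t₀) (fun _ => hl)
    (fun t => ⟨(h.1 t).prodMk (h.2 t), hv t, trivial⟩)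
    (fun t => ⟨(h'.1 t).prodMk (h'.2 t), hv' t, trivial⟩) (by simp [h1, h2])
  funext t
  exact congrArg Prod.fst (congrFun this t)

lemma deriv_lim_zero {f f' : ℝ → ℝ} (hf : ∀ t, HasDerivAt f (f' t) t) {l d : ℝ}
    (hl : Tendsto f atTop (𝓝 l)) (hd : Tendsto f' atTop (𝓝 d)) : d = 0 := by
  have hex : ∀ t : ℝ, ∃ x, t < x ∧ f' x = f (t + 1) - f t := by
    intro t
    obtain ⟨x, hx, h⟩ := exists_hasDerivAt_eq_slope f f' (lt_add_one t)
      (fun x _ => (hf x).continuousAt.continuousWithinAt) (fun x _ => hf x)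
    exact ⟨x, hx.1, by rw [h]; simp⟩
  choose ξ h1 h2 using hex
  have hξ : Tendsto ξ atTop atTop := tendsto_atTop_mono (fun t => (h1 t).le) tendsto_id
  have ha := hd.comp hξ
  have hb : Tendsto (fun t => f (t + 1) - f t) atTop (𝓝 (l - l)) :=
    (hl.comp (tendsto_atTop_add_const_right _ 1 tendsto_id)).sub hl
  rw [sub_self] at hb
  exact tendsto_nhds_unique ha (by simpa [Function.comp_def, h2] using hb)

/-- There is a positive time at which the velocity vanishes. -/
lemma exists_turn {c p H : ℝ} (hc : 0 < c) (hp : 2 < p) (hH : dF c p (ds p) < H)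
    {v w : ℝ → ℝ} (h : IsSol c p v w) (hpos : ∀ t, 0 < v t) (hlt : ∀ t, v t < 1)
    (hE : ∀ t, w t ^ 2 + dF c p (v t) = H) (hw : w 0 = 0) (hg : 0 < dg c p (v 0)) :
    ∃ T, 0 < T ∧ w T = 0 := by
  by_contra hcon
  push Not at hcon
  have hwc : Continuous w := continuous_iff_continuousAt.2 fun t => (h.2 t).continuousAt
  obtain ⟨a, ha, hwa⟩ : ∃ a, 0 < a ∧ 0 < w a := by
    by_contra hno
    push Not at hno
    have hs := (hasDerivWithinAt_iff_tendsto_slope' (self_notMem_Ioi (a := (0:ℝ)))).1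
      ((h.2 0).hasDerivWithinAt (s := Ioi 0))
    have := le_of_tendsto hs (b := 0) (by
      filter_upwards [self_mem_nhdsWithin] with t ht
      rw [slope_def_field, hw]
      exact div_nonpos_of_nonpos_of_nonneg (by linarith [hno t ht]) (by linarith [mem_Ioi.1 ht]))
    linarith
  have hwpos : ∀ t, 0 < t → 0 < w t := by
    intro t ht
    by_contra hn
    push Not at hn
    have : (0:ℝ) ∈ w '' (uIcc t a) :=
      intermediate_value_uIcc hwc.continuousOn (by
        rw [uIcc_of_le (by linarith)]; exact ⟨hn, hwa.le⟩)
    obtain ⟨x, hx, hx0⟩ := this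
    exact hcon x (lt_of_lt_of_le (lt_min ht ha) hx.1) hx0
  have hmono : MonotoneOn v (Ici 0) := by
    apply monotoneOn_of_deriv_nonneg (convex_Ici _)
      (fun t _ => (h.1 t).continuousAt.continuousWithinAt)
      (fun t _ => (h.1 t).differentiableAt.differentiableWithinAt)
    intro t ht
    rw [interior_Ici] at ht
    rw [(h.1 t).deriv]
    exact (hwpos t ht).le
  obtain ⟨l, hl⟩ : ∃ l, Tendsto v atTop (𝓝 l) := by
    have hm : Monotone (fun t => v (max t 0)) := fun x y hxy =>
      hmono (mem_Ici.2 (le_max_right _ _)) (mem_Ici.2 (le_max_right _ _)) (max_le_max_right _ hxy)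
    have := tendsto_atTop_ciSup hm ⟨1, by rintro _ ⟨t, rfl⟩; exact (hlt _).le⟩
    refine ⟨_, this.congr' ?_⟩
    filter_upwards [eventually_ge_atTop 0] with t ht
    rw [max_eq_left ht]
  have hlpos : 0 < l := lt_of_lt_of_le (hpos 0) (ge_of_tendsto hl (by
    filter_upwards [eventually_ge_atTop 0] with t ht
    exact hmono self_mem_Ici ht ht))
  have hwl : Tendsto w atTop (𝓝 (Real.sqrt (H - dF c p l))) := by
    have h1 : Tendsto (fun t => Real.sqrt (H - dF c p (v t))) atTop
        (𝓝 (Real.sqrt (H - dF c p l))) :=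
      ((Real.continuous_sqrt.comp (continuous_const.sub (dF_cont hp))).tendsto l).comp hl
    refine h1.congr' ?_
    filter_upwards [eventually_gt_atTop 0] with t ht
    rw [← hE t, add_sub_cancel_right, Real.sqrt_sq (hwpos t ht).le]
  have hd0 := deriv_lim_zero h.1 hl hwl
  have hgl : Tendsto (fun t => dg c p (v t)) atTop (𝓝 (dg c p l)) :=
    ((dg_contDiff hp).continuous.tendsto l).comp hl
  have hg0 := deriv_lim_zero h.2 hwl hgl
  have hls := dg_eq_zero hc hp hlpos hg0
  rw [Real.sqrt_eq_zero', hls] at hd0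
  linarith

lemma periodic_of_sol {c p : ℝ} (hp : 2 < p)
    {v w : ℝ → ℝ} (h : IsSol c p v w) (hv : ∀ t, v t ∈ Icc (0:ℝ) 1)
    (hw : w 0 = 0) {T : ℝ} (hwT : w T = 0) (t : ℝ) : v (t + 2 * T) = v t := by
  have key : ∀ S, w S = 0 → ∀ t, v (2 * S - t) = v t := by
    intro S hS t
    have hsol : IsSol c p (fun t => v (2 * S - t)) (fun t => - w (2 * S - t)) := by
      have hd : ∀ t, HasDerivAt (fun t : ℝ => 2 * S - t) (-1) t := fun t => by
        simpa using (hasDerivAt_id t).const_sub (2 * S)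
      refine ⟨fun t => ?_, fun t => ?_⟩
      · exact ((h.1 _).comp t (hd t)).congr_deriv (by simp)
      · exact ((h.2 _).comp t (hd t)).neg.congr_deriv (by simp)
    have := sol_unique hp hsol h (fun t => hv _) hv S (by simp [two_mul]) (by simp [two_mul, hS])
    exact congrFun this t
  have h1 := key T hwT (-t)
  have h2 := key 0 hw t
  simp only [mul_zero, zero_sub] at h2
  rw [← h2, ← h1]; congr 1; ring

/-- Global existence for bounded globally Lipschitz autonomous fields. -/
lemma global_exists {X : ℝ × ℝ → ℝ × ℝ} {K L : NNReal} (hX : LipschitzWith K X)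
    (hL : ∀ q, ‖X q‖ ≤ L) (q₀ : ℝ × ℝ) :
    ∃ γ : ℝ → ℝ × ℝ, γ 0 = q₀ ∧ ∀ t, HasDerivAt γ (X (γ t)) t := by
  have hloc : ∀ N : ℕ, ∃ γ : ℝ → ℝ × ℝ, γ 0 = q₀ ∧
      ∀ t ∈ Ioo (-(N:ℝ)) N, HasDerivAt γ (X (γ t)) t := by
    intro N
    have hpl : IsPicardLindelof (fun _ => X) (tmin := -(N:ℝ)) (tmax := N)
        ⟨0, by constructor <;> simp⟩ q₀ (L * N) 0 L K :=
      { lipschitzOnWith := fun t _ => hX.lipschitzOnWith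
        continuousOn := fun x _ => continuousOn_const
        norm_le := fun t _ x _ => hL x
        mul_max_le := by simp }
    obtain ⟨γ, h0, h⟩ := hpl.exists_eq_forall_mem_Icc_hasDerivWithinAt₀
    exact ⟨γ, h0, fun t ht => (h t (Ioo_subset_Icc_self ht)).hasDerivAt (Icc_mem_nhds ht.1 ht.2)⟩
  choose γ h0 hγ using hloc
  have hagree : ∀ M N : ℕ, M ≤ N → ∀ t ∈ Ioo (-(M:ℝ)) M, γ M t = γ N t := by
    intro M N hMN t ht
    have hM : (0:ℝ) < M := by linarith [ht.1, ht.2]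
    have hMN' : (M:ℝ) ≤ N := by exact_mod_cast hMN
    refine ODE_solution_unique_of_mem_Ioo (v := fun _ => X) (s := fun _ => univ) (K := K)
      (t₀ := 0) (a := -(M:ℝ)) (b := M) (fun _ _ => hX.lipschitzOnWith) ⟨by linarith, hM⟩
      (fun s hs => ⟨hγ M s hs, trivial⟩)
      (fun s hs => ⟨hγ N s ⟨by linarith [hs.1], by linarith [hs.2]⟩, trivial⟩)
      (by rw [h0, h0]) ht
  have hmem : ∀ t : ℝ, t ∈ Ioo (-((⌈|t|⌉₊ + 1 : ℕ) : ℝ)) ((⌈|t|⌉₊ + 1 : ℕ) : ℝ) := by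
    intro t
    have := Nat.le_ceil |t|
    push_cast
    exact abs_lt.1 (by linarith)
  refine ⟨fun t => γ (⌈|t|⌉₊ + 1) t, h0 _, fun t => ?_⟩
  refine (hγ _ t (hmem t)).congr_of_eventuallyEq ?_
  filter_upwards [Ioo_mem_nhds (hmem t).1 (hmem t).2] with s hs
  rcases le_total (⌈|s|⌉₊ + 1) (⌈|t|⌉₊ + 1) with hle | hle
  · exact hagree _ _ hle s (hmem s)
  · exact (hagree _ _ hle s hs).symm

/-- Truncation to `[a, b]`. -/
noncomputable def clamp (a b x : ℝ) : ℝ := max a (min b x)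

lemma clamp_lip (a b : ℝ) : LipschitzWith 1 (clamp a b) :=
  (LipschitzWith.id.const_min b).const_max a

lemma clamp_mem {a b : ℝ} (h : a ≤ b) (x : ℝ) : clamp a b x ∈ Icc a b :=
  ⟨le_max_left _ _, max_le h (min_le_left _ _)⟩

lemma clamp_of_mem {a b x : ℝ} (h : x ∈ Icc a b) : clamp a b x = x := by
  unfold clamp; rw [min_eq_right h.2, max_eq_right h.1]

lemma clamp_of_ge {a b x : ℝ} (hab : a ≤ b) (h : b ≤ x) : clamp a b x = b := by
  unfold clamp; rw [min_eq_left h, max_eq_right hab]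

lemma clamp_of_le {a b x : ℝ} (hab : a ≤ b) (h : x ≤ a) : clamp a b x = a := by
  unfold clamp; rw [min_eq_right (h.trans hab), max_eq_left h]

/-- Truncated kinetic energy. -/
lemma kinetic {M : ℝ} (hM : 0 < M) : ∃ Ψ : ℝ → ℝ, (∀ w, HasDerivAt Ψ (clamp (-M) M w) w) ∧
    Ψ 0 = 0 ∧ (∀ w, 0 ≤ Ψ w) ∧ (∀ w, Ψ w < M ^ 2 / 2 → w ∈ Icc (-M) M) := by
  have hcont : Continuous (clamp (-M) M) := (clamp_lip _ _).continuous
  let Ψ : ℝ → ℝ := fun w => ∫ s in (0:ℝ)..w, clamp (-M) M s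
  have hΨ : ∀ w, HasDerivAt Ψ (clamp (-M) M w) w := fun w =>
    intervalIntegral.integral_hasDerivAt_right (hcont.intervalIntegrable _ _)
      (hcont.stronglyMeasurableAtFilter _ _) hcont.continuousAt
  have hcΨ : Continuous Ψ := continuous_iff_continuousAt.2 fun w => (hΨ w).continuousAt
  have h0 : Ψ 0 = 0 := by simp [Ψ]
  have hmono : MonotoneOn Ψ (Ici 0) := by
    apply monotoneOn_of_deriv_nonneg (convex_Ici _) hcΨ.continuousOn
      (fun t _ => (hΨ t).differentiableAt.differentiableWithinAt)
    intro x hx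
    rw [interior_Ici, mem_Ioi] at hx
    rw [(hΨ x).deriv]
    exact le_max_of_le_right (le_min hM.le hx.le)
  have hanti : AntitoneOn Ψ (Iic 0) := by
    apply antitoneOn_of_deriv_nonpos (convex_Iic _) hcΨ.continuousOn
      (fun t _ => (hΨ t).differentiableAt.differentiableWithinAt)
    intro x hx
    rw [interior_Iic, mem_Iio] at hx
    rw [(hΨ x).deriv]
    exact max_le (by linarith) (min_le_of_right_le hx.le)
  have heq : ∀ w ∈ Icc (-M) M, Ψ w = w ^ 2 / 2 := by
    intro w hw
    have : Ψ w = ∫ s in (0:ℝ)..w, s := by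
      apply intervalIntegral.integral_congr
      intro s hs
      exact clamp_of_mem (uIcc_subset_Icc ⟨by linarith, hM.le⟩ hw hs)
    rw [this, integral_id]; ring
  refine ⟨Ψ, hΨ, h0, fun w => ?_, fun w hw => ?_⟩
  · rcases le_total 0 w with h | h
    · rw [← h0]; exact hmono self_mem_Ici h h
    · rw [← h0]; exact hanti h self_mem_Iic h
  · by_contra hn
    rcases le_total 0 w with h | h
    · have hMw : M ≤ w := by
        by_contra h'; exact hn ⟨by linarith, by linarith⟩
      have := hmono (mem_Ici.2 hM.le) (mem_Ici.2 h) hMw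
      rw [heq M ⟨by linarith, le_rfl⟩] at this
      linarith
    · have hMw : w ≤ -M := by
        by_contra h'; exact hn ⟨by linarith, by linarith⟩
      have := hanti (mem_Iic.2 h) (mem_Iic.2 (by linarith)) hMw
      rw [heq (-M) ⟨le_rfl, by linarith⟩] at this
      linarith [neg_sq M]

/-- Truncated potential energy. -/
lemma potential {c p : ℝ} (hc : 0 < c) (hp : 2 < p) : ∃ Φ : ℝ → ℝ,
    (∀ x, HasDerivAt Φ (-2 * dg c p (clamp 0 1 x)) x) ∧
    (∀ x ∈ Icc (0:ℝ) 1, Φ x = dF c p x) ∧ (∀ x, x ≤ 0 → 0 ≤ Φ x) ∧ (∀ x, 1 ≤ x → 0 ≤ Φ x) := by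
  have hcont : Continuous (fun x => -2 * dg c p (clamp 0 1 x)) :=
    continuous_const.mul ((dg_contDiff hp).continuous.comp (clamp_lip _ _).continuous)
  let Φ : ℝ → ℝ := fun x => ∫ s in (0:ℝ)..x, -2 * dg c p (clamp 0 1 s)
  have hΦ : ∀ x, HasDerivAt Φ (-2 * dg c p (clamp 0 1 x)) x := fun x =>
    intervalIntegral.integral_hasDerivAt_right (hcont.intervalIntegrable _ _)
      (hcont.stronglyMeasurableAtFilter _ _) hcont.continuousAt
  have hcΦ : Continuous Φ := continuous_iff_continuousAt.2 fun w => (hΦ w).continuousAt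
  have h0 : Φ 0 = 0 := by simp [Φ]
  have heq : ∀ x ∈ Icc (0:ℝ) 1, Φ x = dF c p x := by
    intro x hx
    have h1 : Φ x = ∫ s in (0:ℝ)..x, -2 * dg c p s := by
      apply intervalIntegral.integral_congr
      intro s hs
      simp only
      rw [clamp_of_mem (uIcc_subset_Icc ⟨by linarith, by linarith⟩ hx hs)]
    rw [h1, intervalIntegral.integral_eq_sub_of_hasDerivAt (fun s _ => dF_hasDerivAt hp s)
      ((continuous_const.mul (dg_contDiff hp).continuous).intervalIntegrable _ _), dF_zero hp,
      sub_zero]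
  refine ⟨Φ, hΦ, heq, fun x hx => ?_, fun x hx => ?_⟩
  · have hanti : AntitoneOn Φ (Iic 0) := by
      apply antitoneOn_of_deriv_nonpos (convex_Iic _) hcΦ.continuousOn
        (fun t _ => (hΦ t).differentiableAt.differentiableWithinAt)
      intro x hx
      rw [interior_Iic, mem_Iio] at hx
      rw [(hΦ x).deriv, clamp_of_le zero_le_one hx.le]
      unfold dg
      rw [Real.zero_rpow (by linarith)]; simp
    rw [← h0]; exact hanti hx self_mem_Iic hx
  · have hmono : MonotoneOn Φ (Ici 1) := by
      apply monotoneOn_of_deriv_nonneg (convex_Ici _) hcΦ.continuousOn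
        (fun t _ => (hΦ t).differentiableAt.differentiableWithinAt)
      intro x hx
      rw [interior_Ici, mem_Ioi] at hx
      rw [(hΦ x).deriv, clamp_of_ge zero_le_one hx.le]
      unfold dg
      rw [Real.one_rpow]; nlinarith
    have h1 : Φ 1 = 0 := by
      rw [heq 1 ⟨zero_le_one, le_rfl⟩]; unfold dF; simp
    rw [← h1]; exact hmono self_mem_Ici hx hx

lemma exists_sol {c p x₀ : ℝ} (hc : 0 < c) (hp : 2 < p) (hx : 0 < x₀) (hx1 : x₀ < 1)
    (hF : dF c p x₀ < 0) :
    ∃ v w, IsSol c p v w ∧ v 0 = x₀ ∧ w 0 = 0 ∧ (∀ t, 0 < v t) ∧ ∀ t, v t < 1 := by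
  have hM : 0 < Real.sqrt c := Real.sqrt_pos.2 hc
  have hM2 : Real.sqrt c ^ 2 = c := Real.sq_sqrt hc.le
  set M := Real.sqrt c
  obtain ⟨Ψ, hΨ, hΨ0, hΨn, hΨb⟩ := kinetic hM
  obtain ⟨Φ, hΦ, hΦe, hΦl, hΦr⟩ := potential hc hp
  obtain ⟨K, hK⟩ := exists_lip (c := c) hp
  let X : ℝ × ℝ → ℝ × ℝ := fun q => (clamp (-M) M q.2, dg c p (clamp 0 1 q.1))
  have hX : LipschitzWith (max 1 K) X := by
    apply LipschitzWith.prodMk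
    · simpa [Function.comp_def] using
        (clamp_lip (-M) M).comp (LipschitzWith.prod_snd (α := ℝ) (β := ℝ))
    · have h1 : LipschitzOnWith K (fun x => dg c p (clamp 0 1 x)) univ := by
        have := hK.comp (clamp_lip 0 1).lipschitzOnWith (s := univ)
          (fun x _ => clamp_mem zero_le_one x)
        simpa [Function.comp_def] using this
      simpa [Function.comp_def] using
        (lipschitzOnWith_univ.1 h1).comp (LipschitzWith.prod_fst (α := ℝ) (β := ℝ))
  obtain ⟨B, hB⟩ := isCompact_Icc.exists_bound_of_continuousOn
    (dg_contDiff (c := c) hp).continuous.continuousOn (s := Icc (0:ℝ) 1)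
  have hL : ∀ q, ‖X q‖ ≤ (max M B).toNNReal := by
    intro q
    rw [Real.coe_toNNReal _ (le_max_of_le_left hM.le)]
    refine max_le_max ?_ (hB _ (clamp_mem zero_le_one _))
    exact abs_le.2 (clamp_mem (by linarith) _)
  obtain ⟨γ, h0, hγ⟩ := global_exists hX hL (x₀, 0)
  have hv : ∀ t, HasDerivAt (fun t => (γ t).1) (clamp (-M) M (γ t).2) t := fun t =>
    (hasFDerivAt_fst (𝕜 := ℝ) (p := γ t)).comp_hasDerivAt t (hγ t)
  have hw : ∀ t, HasDerivAt (fun t => (γ t).2) (dg c p (clamp 0 1 (γ t).1)) t := fun t =>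
    (hasFDerivAt_snd (𝕜 := ℝ) (p := γ t)).comp_hasDerivAt t (hγ t)
  have hE : ∀ t, 2 * Ψ (γ t).2 + Φ (γ t).1 = dF c p x₀ := by
    intro t
    have hd : ∀ t, HasDerivAt (fun t => 2 * Ψ (γ t).2 + Φ (γ t).1) 0 t := by
      intro t
      have h1 := ((hΨ (γ t).2).comp t (hw t)).const_mul 2
      have h2 := (hΦ (γ t).1).comp t (hv t)
      exact (h1.add h2).congr_deriv (by ring)
    have := is_const_of_deriv_eq_zero (fun t => (hd t).differentiableAt)
      (fun t => (hd t).deriv) t 0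
    rw [this, h0]
    simp [hΨ0, hΦe x₀ ⟨hx.le, hx1.le⟩]
  have hpos : ∀ t, 0 < (γ t).1 := by
    intro t
    by_contra hn
    linarith [hE t, hΨn (γ t).2, hΦl _ (not_lt.1 hn)]
  have hlt : ∀ t, (γ t).1 < 1 := by
    intro t
    by_contra hn
    linarith [hE t, hΨn (γ t).2, hΦr _ (not_lt.1 hn)]
  have hwm : ∀ t, (γ t).2 ∈ Icc (-M) M := by
    intro t
    apply hΨb
    have h1 := hE t
    rw [hΦe _ ⟨(hpos t).le, (hlt t).le⟩] at h1
    have := dF_ge (p := p) hc (hpos t).le (hlt t).le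
    rw [hM2]; linarith
  refine ⟨fun t => (γ t).1, fun t => (γ t).2, ⟨fun t => ?_, fun t => ?_⟩, by simp [h0],
    by simp [h0], hpos, hlt⟩
  · have := hv t; rwa [clamp_of_mem (hwm t)] at this
  · have := hw t; rwa [clamp_of_mem ⟨(hpos t).le, (hlt t).le⟩] at this

lemma ds_lt_one {p : ℝ} (hp : 2 < p) : ds p < 1 :=
  Real.rpow_lt_one (by positivity) (by rw [div_lt_one (by linarith)]; exact hp)
    (one_div_pos.2 (by linarith))

lemma sol_facts (n : ℕ) (hn : 3 ≤ n) {c p H₀ : ℝ} (hcd : c = ((n:ℝ) - 2) ^ 2 / 4)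
    (hpd : p = 2 * n / ((n:ℝ) - 2)) (v : ℝ → ℝ) :
    DelaunaySol n H₀ v ↔ (∃ C : ℝ, ∀ t : ℝ, |v t| ≤ C) ∧ ContDiff ℝ 2 v ∧ (∀ t, 0 < v t) ∧
      (∀ t, deriv (deriv v) t = dg c p (v t)) ∧ dF c p (v 0) = H₀ ∧ deriv v 0 = 0 ∧
      0 < dg c p (v 0) := by
  have hn' : (3:ℝ) ≤ n := by exact_mod_cast hn
  have h2 : (n:ℝ) - 2 ≠ 0 := by linarith
  have e1 : ((n : ℝ) + 2) / ((n : ℝ) - 2) = p - 1 := by rw [hpd]; field_simp; ring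
  have e2 : (n : ℝ) * ((n : ℝ) - 2) / 4 = c * p / 2 := by rw [hpd, hcd]; field_simp
  unfold DelaunaySol DelaunayODE delaunayH
  rw [e1, e2, ← hcd, ← hpd]
  have e3 : (∀ t : ℝ, deriv (deriv v) t - c * v t + c * p / 2 * v t ^ (p - 1) = 0) ↔
      ∀ t, deriv (deriv v) t = dg c p (v t) := by
    refine forall_congr' fun t => ?_
    unfold dg
    constructor <;> intro h <;> linarith
  rw [e3]
  refine and_congr_right fun _ => and_congr_right fun _ => and_congr_right fun _ =>
    and_congr_right fun h => ?_
  rw [h 0]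
  constructor
  · rintro ⟨h1, h3, h4⟩
    refine ⟨?_, h3, h4⟩
    rw [h3] at h1; unfold dF; linarith
  · rintro ⟨h1, h3, h4⟩
    refine ⟨?_, h3, h4⟩
    rw [h3]; unfold dF at h1; linarith

lemma isSol_of_c2 {c p : ℝ} {v : ℝ → ℝ} (h : ContDiff ℝ 2 v)
    (h' : ∀ t, deriv (deriv v) t = dg c p (v t)) : IsSol c p v (deriv v) := by
  have h1 : ContDiff ℝ 1 (deriv v) := by
    have : ContDiff ℝ (1 + 1) v := by norm_num; exact h
    exact (contDiff_succ_iff_deriv.1 this).2.2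
  refine ⟨fun t => (h.differentiable (by norm_num) t).hasDerivAt, fun t => ?_⟩
  rw [← h' t]
  exact (h1.differentiable (by norm_num) t).hasDerivAt

lemma c2_of_isSol {c p : ℝ} (hp : 2 < p) {v w : ℝ → ℝ} (h : IsSol c p v w) :
    ContDiff ℝ 2 v ∧ deriv v = w ∧ ∀ t, deriv (deriv v) t = dg c p (v t) := by
  have h1 : deriv v = w := funext fun t => (h.1 t).deriv
  have h2 : deriv w = fun t => dg c p (v t) := funext fun t => (h.2 t).deriv
  have hvc : Continuous v := continuous_iff_continuousAt.2 fun t => (h.1 t).continuousAt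
  have hw1 : ContDiff ℝ 1 w := by
    rw [contDiff_one_iff_deriv]
    refine ⟨fun t => (h.2 t).differentiableAt, ?_⟩
    rw [h2]; exact (dg_contDiff hp).continuous.comp hvc
  refine ⟨?_, h1, fun t => by rw [h1, h2]⟩
  have : ContDiff ℝ (1 + 1) v := by
    rw [contDiff_succ_iff_deriv]
    refine ⟨fun t => (h.1 t).differentiableAt, by simp, by rwa [h1]⟩
  norm_num at this; exact this

theorem stmt_5 (n : ℕ) (hn : 3 ≤ n) (H₀ : ℝ)
    (hlow : -(((n : ℝ) - 2) / 2) * (((n : ℝ) - 2) / n) ^ ((n : ℝ) / 2) < H₀)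
    (hup : H₀ < 0) :
    (∃! v : ℝ → ℝ, DelaunaySol n H₀ v) ∧
    ∀ v : ℝ → ℝ, DelaunaySol n H₀ v →
      (∃ T : ℝ, 0 < T ∧ ∀ t : ℝ, v (t + T) = v t) ∧
      (∀ t : ℝ, 0 < v t ∧ v t < 1) ∧
      (∀ t : ℝ, v 0 ≤ v t) ∧
      0 < v 0 ∧ v 0 < (((n : ℝ) - 2) / n) ^ (((n : ℝ) - 2) / 4) := by
  have hn' : (3:ℝ) ≤ n := by exact_mod_cast hn
  have hn2 : 0 < (n:ℝ) - 2 := by linarith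
  obtain ⟨c, hcd⟩ : ∃ c, c = ((n:ℝ) - 2) ^ 2 / 4 := ⟨_, rfl⟩
  obtain ⟨p, hpd⟩ : ∃ p, p = 2 * n / ((n:ℝ) - 2) := ⟨_, rfl⟩
  have hc : 0 < c := by rw [hcd]; positivity
  have hp : 2 < p := by rw [hpd, lt_div_iff₀ hn2]; linarith
  have e1 : 2 / p = ((n:ℝ) - 2) / n := by rw [hpd]; field_simp
  have e2 : 1 / (p - 2) = ((n:ℝ) - 2) / 4 := by
    have : p - 2 = 4 / ((n:ℝ) - 2) := by rw [hpd]; field_simp; ring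
    rw [this]; field_simp
  have hds : (((n : ℝ) - 2) / n) ^ (((n : ℝ) - 2) / 4) = ds p := by
    unfold ds; rw [e1, e2]
  have hFs : dF c p (ds p) = -(((n : ℝ) - 2) / 2) * (((n : ℝ) - 2) / n) ^ ((n : ℝ) / 2) := by
    have hb : 0 < ((n : ℝ) - 2) / n := by positivity
    unfold dF
    rw [← hds, ← Real.rpow_two, ← Real.rpow_mul hb.le, ← Real.rpow_mul hb.le]
    have a1 : ((n : ℝ) - 2) / 4 * p = n / 2 := by rw [hpd]; field_simp; ring
    have a2 : (n : ℝ) / 2 = ((n : ℝ) - 2) / 4 * 2 + 1 := by ring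
    rw [a1, a2, Real.rpow_add_one hb.ne', hcd]
    field_simp; ring
  rw [← hFs] at hlow
  rw [hds]
  -- facts about any solution
  have facts : ∀ v, DelaunaySol n H₀ v → IsSol c p v (deriv v) ∧ (∀ t, 0 < v t) ∧
      (∀ t, v t < 1) ∧ (∀ t, deriv v t ^ 2 + dF c p (v t) = H₀) ∧ deriv v 0 = 0 ∧
      v 0 < ds p ∧ dF c p (v 0) = H₀ ∧ 0 < dg c p (v 0) := by
    intro v hv
    obtain ⟨-, h2, hpos, hode, hF, hd, hg⟩ := (sol_facts n hn hcd hpd v).1 hv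
    have hsol := isSol_of_c2 h2 hode
    have hE : ∀ t, deriv v t ^ 2 + dF c p (v t) = H₀ := by
      intro t
      rw [energy hp hsol t, hd, hF]; ring
    refine ⟨hsol, hpos, fun t => lt_one_of_dF_neg hc hp ?_, hE, hd,
      (dg_pos_iff hc hp (hpos 0)).1 hg, hF, hg⟩
    nlinarith [hE t, sq_nonneg (deriv v t)]
  refine ⟨?_, ?_⟩
  · apply existsUnique_of_exists_of_unique
    · obtain ⟨x, hx, hxF⟩ : H₀ ∈ dF c p '' Ioo 0 (ds p) := by
        apply intermediate_value_Ioo' (ds_pos hp).le (dF_cont hp).continuousOn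
        rw [dF_zero hp]; exact ⟨hlow, hup⟩
      obtain ⟨v, w, hs, h0, hw0, hpos, hlt⟩ := exists_sol hc hp hx.1
        (hx.2.trans (ds_lt_one hp)) (by rw [hxF]; exact hup)
      obtain ⟨hC, hdv, hdd⟩ := c2_of_isSol hp hs
      refine ⟨v, (sol_facts n hn hcd hpd v).2 ⟨⟨1, fun t => ?_⟩, hC, hpos, hdd, ?_, ?_, ?_⟩⟩
      · rw [abs_of_pos (hpos t)]; exact (hlt t).le
      · rw [h0, hxF]
      · rw [hdv, hw0]
      · rw [h0]; exact (dg_pos_iff hc hp hx.1).2 hx.2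
    · intro v v' hv hv'
      obtain ⟨hs, hpos, hlt, -, hd, hlts, hF, -⟩ := facts v hv
      obtain ⟨hs', hpos', hlt', -, hd', hlts', hF', -⟩ := facts v' hv'
      refine sol_unique hp hs hs' (fun t => ⟨(hpos t).le, (hlt t).le⟩)
        (fun t => ⟨(hpos' t).le, (hlt' t).le⟩) 0 ?_ (by rw [hd, hd'])
      exact (dF_anti hc hp).injOn ⟨(hpos 0).le, hlts.le⟩ ⟨(hpos' 0).le, hlts'.le⟩
        (by rw [hF, hF'])
  · intro v hv
    obtain ⟨hs, hpos, hlt, hE, hd, hlts, hF, hg⟩ := facts v hv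
    obtain ⟨T, hT, hwT⟩ := exists_turn hc hp hlow hs hpos hlt hE hd hg
    refine ⟨⟨2 * T, by linarith, periodic_of_sol hp hs
      (fun t => ⟨(hpos t).le, (hlt t).le⟩) hd hwT⟩, fun t => ⟨hpos t, hlt t⟩, fun t => ?_,
      hpos 0, hlts⟩
    by_contra hn
    push Not at hn
    have := dF_anti hc hp ⟨(hpos t).le, (hn.trans hlts).le⟩ ⟨(hpos 0).le, hlts.le⟩ hn
    nlinarith [hE t, sq_nonneg (deriv v t)]
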